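/- arXiv:2301.08206 — 2 statements merged into one kernel-verified Lean document; each statement's English description precedes it below -/
import Mathlib

section
/- Let $L$ be a finite distributive lattice and let $L^*$ be its dual lattice. Fix $p \in (0,1]$. Then the expected number of steps of the Ungarian Markov chain from top to bottom satisfies $\mathcal{E}(L^*) = \mathcal{E}(L)$. -/
open Finset
open scoped Classical

/-- The set of elements covered by `x`. -/
noncomputable def ungarCov {L : Type*} [Fintype L] [Preorder L] (x : L) : Finset L :=
  Finset.univ.filter (fun y => y ⋖ x)

/-- Transition probabilities of the Ungarian Markov chain. -/
noncomputable def ungarP {L : Type*} [Fintype L] [Lattice L] [BoundedOrder L]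
    (p : ℝ) (x y : L) : ℝ :=
  ∑ T ∈ (ungarCov x).powerset.filter (fun T => (insert x T).inf id = y),
    p ^ T.card * (1 - p) ^ ((ungarCov x).card - T.card)

/-- `E` is the expected-number-of-steps-to-`⊥` function of the Ungarian Markov chain. -/
def IsUngarExp {L : Type*} [Fintype L] [Lattice L] [BoundedOrder L]
    (p : ℝ) (E : L → ℝ) : Prop :=
  E ⊥ = 0 ∧ ∀ x : L, x ≠ ⊥ → E x = 1 + ∑ y : L, ungarP p x y * E y

section Markov

variable {L : Type*} [Fintype L] [Lattice L] [BoundedOrder L]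

theorem ungarP_nonneg {p : ℝ} (hp : 0 ≤ p) (hp1 : p ≤ 1) (x y : L) : 0 ≤ ungarP p x y :=
  Finset.sum_nonneg fun _ _ => mul_nonneg (pow_nonneg hp _) (pow_nonneg (by linarith) _)

theorem sum_ungarP_mul (p : ℝ) (x : L) (f : L → ℝ) :
    ∑ y, ungarP p x y * f y = ∑ T ∈ (ungarCov x).powerset,
      p ^ T.card * (1 - p) ^ ((ungarCov x).card - T.card) * f (x ⊓ T.inf id) := by
  rw [← Finset.sum_fiberwise (ungarCov x).powerset (fun T => (insert x T).inf id)]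
  refine Finset.sum_congr rfl fun y _ => ?_
  rw [ungarP, Finset.sum_mul]
  refine Finset.sum_congr rfl fun T hT => ?_
  rw [← (Finset.mem_filter.1 hT).2, Finset.inf_insert, id]

theorem sum_ungarP (p : ℝ) (x : L) : ∑ y, ungarP p x y = 1 := by
  have h := sum_ungarP_mul p x (fun _ => 1)
  simp only [mul_one] at h
  rw [h, Finset.sum_pow_mul_eq_add_pow]
  simp

theorem sum_ungarP_bot_mul (p : ℝ) (f : L → ℝ) : ∑ y, ungarP p ⊥ y * f y = f ⊥ := by
  have h : ungarCov (⊥ : L) = ∅ := by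
    ext y
    simp [ungarCov]
  rw [sum_ungarP_mul, h]
  simp

/-- The transition matrix of the Ungarian Markov chain. -/
noncomputable def ungarMatrix (L : Type*) [Fintype L] [Lattice L] [BoundedOrder L] (p : ℝ) :
    Matrix L L ℝ :=
  Matrix.of (ungarP p)

open Matrix

theorem ungarMatrix_pow_mulVec_one (p : ℝ) (n : ℕ) : (ungarMatrix L p ^ n) *ᵥ 1 = 1 := by
  induction n with
  | zero => simp
  | succ n ih =>
    have h : ungarMatrix L p *ᵥ 1 = 1 := by
      ext x
      simp [ungarMatrix, Matrix.mulVec, dotProduct, sum_ungarP]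
    rw [pow_succ, ← Matrix.mulVec_mulVec, h, ih]

theorem ungarMatrix_mulVec_mono {p : ℝ} (hp : 0 ≤ p) (hp1 : p ≤ 1) {f g : L → ℝ} (h : f ≤ g) :
    ungarMatrix L p *ᵥ f ≤ ungarMatrix L p *ᵥ g := fun x =>
  Finset.sum_le_sum fun y _ => mul_le_mul_of_nonneg_left (h y) (ungarP_nonneg hp hp1 x y)

namespace IsUngarExp

variable {p : ℝ} {E : L → ℝ}

theorem eq_add_mulVec (hE : IsUngarExp p E) :
    E = (1 - Pi.single ⊥ 1) + ungarMatrix L p *ᵥ E := by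
  ext x
  by_cases hx : x = ⊥
  · subst hx
    have h := sum_ungarP_bot_mul p E
    simp [ungarMatrix, Matrix.mulVec, dotProduct, h]
  · simpa [ungarMatrix, Matrix.mulVec, dotProduct, hx] using hE.2 x hx

theorem nonneg (hp : 0 ≤ p) (hp1 : p ≤ 1) (hE : IsUngarExp p E) (x : L) : 0 ≤ E x := by
  obtain ⟨m, hm⟩ := Finite.exists_min E
  suffices m = ⊥ by
    rw [← hE.1, ← this]
    exact hm x
  by_contra h
  have h1 := hE.2 m h
  have h2 : ∑ y, ungarP p m y * E m ≤ ∑ y, ungarP p m y * E y :=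
    Finset.sum_le_sum fun y _ => mul_le_mul_of_nonneg_left (hm y) (ungarP_nonneg hp hp1 m y)
  rw [← Finset.sum_mul, sum_ungarP] at h2
  linarith

theorem exists_mulVec_le (hp : 0 ≤ p) (hp1 : p ≤ 1) (hE : IsUngarExp p E) :
    ∃ r : ℝ, 0 ≤ r ∧ r < 1 ∧ ungarMatrix L p *ᵥ E ≤ r • E := by
  obtain ⟨m, hm⟩ := Finite.exists_max E
  have h0 := hE.nonneg hp hp1
  have hC : 0 < E m + 1 := by linarith [h0 m]
  refine ⟨1 - (E m + 1)⁻¹, sub_nonneg.2 (inv_le_one_of_one_le₀ (by linarith [h0 m])),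
    by linarith [inv_pos.2 hC], fun x => ?_⟩
  have h := congrFun hE.eq_add_mulVec x
  by_cases hx : x = ⊥
  · subst hx
    simp [hE.1] at h
    simp [hE.1, ← h]
  · simp [hx] at h
    have h2 : (E m + 1)⁻¹ * E x ≤ 1 := by
      rw [inv_mul_le_one₀ hC]
      linarith [hm x]
    simp only [Pi.smul_apply, smul_eq_mul]
    linarith

theorem sum_add_pow_mulVec (hE : IsUngarExp p E) (x : L) (N : ℕ) :
    E x = ∑ n ∈ Finset.range N, (1 - (ungarMatrix L p ^ n) x ⊥) +
      ((ungarMatrix L p ^ N) *ᵥ E) x := by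
  induction N with
  | zero => simp
  | succ N ih =>
    have h : (ungarMatrix L p ^ N) *ᵥ E = (1 - (ungarMatrix L p ^ N) *ᵥ Pi.single ⊥ 1) +
        (ungarMatrix L p ^ (N + 1)) *ᵥ E := by
      conv_lhs => rw [hE.eq_add_mulVec]
      rw [Matrix.mulVec_add, Matrix.mulVec_sub, ungarMatrix_pow_mulVec_one,
        Matrix.mulVec_mulVec, pow_succ]
    rw [Finset.sum_range_succ, add_assoc, ih, h]
    simp

/-- The expected absorption time is the sum of the tail probabilities. -/
theorem tendsto_sum (hp : 0 ≤ p) (hp1 : p ≤ 1) (hE : IsUngarExp p E) (x : L) :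
    Filter.Tendsto (fun N => ∑ n ∈ Finset.range N, (1 - (ungarMatrix L p ^ n) x ⊥))
      Filter.atTop (nhds (E x)) := by
  obtain ⟨r, hr0, hr1, hr⟩ := hE.exists_mulVec_le hp hp1
  have hE0 : 0 ≤ E := hE.nonneg hp hp1
  have bound : ∀ N, 0 ≤ (ungarMatrix L p ^ N) *ᵥ E ∧ (ungarMatrix L p ^ N) *ᵥ E ≤ r ^ N • E := by
    intro N
    induction N with
    | zero => simpa using hE0
    | succ N ih =>
      rw [pow_succ', ← Matrix.mulVec_mulVec]
      constructor
      · simpa using ungarMatrix_mulVec_mono hp hp1 ih.1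
      · refine (ungarMatrix_mulVec_mono hp hp1 ih.2).trans ?_
        rw [Matrix.mulVec_smul, pow_succ, mul_smul]
        exact smul_le_smul_of_nonneg_left hr (pow_nonneg hr0 N)
  have hlim : Filter.Tendsto (fun N => ((ungarMatrix L p ^ N) *ᵥ E) x)
      Filter.atTop (nhds 0) := by
    refine squeeze_zero (fun N => (bound N).1 x) (fun N => (bound N).2 x) ?_
    simpa using (tendsto_pow_atTop_nhds_zero_of_lt_one hr0 hr1).mul_const (E x)
  have h : (fun N => ∑ n ∈ Finset.range N, (1 - (ungarMatrix L p ^ n) x ⊥)) =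
      fun N => E x - ((ungarMatrix L p ^ N) *ᵥ E) x := by
    ext N
    rw [hE.sum_add_pow_mulVec x N]
    ring
  rw [h]
  simpa using hlim.const_sub (E x)

end IsUngarExp

end Markov

section Duality

/-- The elements covered by `x` that lie above `x ⊓ y`. -/
noncomputable def ungarCovAbove {L : Type*} [Fintype L] [Lattice L] (x y : L) : Finset L :=
  (ungarCov x).filter (fun c => x ⊓ y ≤ c)

theorem mem_ungarCovAbove {L : Type*} [Fintype L] [Lattice L] {x y c : L} :
    c ∈ ungarCovAbove x y ↔ c ⋖ x ∧ x ⊓ y ≤ c := by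
  simp [ungarCovAbove, ungarCov]

theorem le_sup_finset_inf {L : Type*} [DistribLattice L] [BoundedOrder L] {a x : L}
    {T : Finset L} (h : ∀ t ∈ T, x ≤ a ⊔ t) :
    x ≤ a ⊔ T.inf id := by
  rw [Finset.inf_sup_distrib_left]
  exact Finset.le_inf h

variable {L : Type*} [Fintype L] [DistribLattice L] [BoundedOrder L]

theorem inf_finset_inf_le_iff {x y : L} {T : Finset L} (hT : T ⊆ ungarCov x) :
    x ⊓ T.inf id ≤ y ↔ ungarCovAbove x y ⊆ T ∧ x ⊓ (ungarCovAbove x y).inf id ≤ y := by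
  have cov : ∀ t ∈ T, t ⋖ x := fun t ht => by simpa [ungarCov] using hT ht
  constructor
  · intro h
    have hS : ungarCovAbove x y ⊆ T := by
      intro c hc
      obtain ⟨hcx, hyc⟩ := mem_ungarCovAbove.1 hc
      by_contra hcT
      have h1 : x ≤ c ⊔ T.inf id := le_sup_finset_inf fun t ht =>
        (hcx.wcovBy.sup_eq (cov t ht).wcovBy fun e => hcT (e ▸ ht)).ge
      have h2 : x ⊓ T.inf id ≤ c := (le_inf inf_le_left h).trans hyc
      have h3 : x ≤ c := by
        calc x ≤ x ⊓ (c ⊔ T.inf id) := le_inf le_rfl h1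
          _ = (x ⊓ c) ⊔ (x ⊓ T.inf id) := inf_sup_left _ _ _
          _ ≤ c := sup_le inf_le_right h2
      exact hcx.lt.not_ge h3
    refine ⟨hS, ?_⟩
    set S := ungarCovAbove x y with hSdef
    have h1 : x ≤ (x ⊓ y) ⊔ (T \ S).inf id := le_sup_finset_inf fun t ht => by
      obtain ⟨htT, htS⟩ := Finset.mem_sdiff.1 ht
      have htx := cov t htT
      have hne : ¬ x ⊓ y ≤ t := fun hle => htS (mem_ungarCovAbove.2 ⟨htx, hle⟩)
      rcases htx.eq_or_eq (le_sup_right : t ≤ (x ⊓ y) ⊔ t) (sup_le inf_le_left htx.le) with e | e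
      · exact absurd (le_sup_left.trans e.le) hne
      · exact e.ge
    have h2 : T.inf id = S.inf id ⊓ (T \ S).inf id := by
      rw [← Finset.inf_union, Finset.union_sdiff_of_subset hS]
    calc x ⊓ S.inf id ≤ (x ⊓ S.inf id) ⊓ ((x ⊓ y) ⊔ (T \ S).inf id) :=
          le_inf le_rfl (inf_le_left.trans h1)
      _ = (x ⊓ S.inf id ⊓ (x ⊓ y)) ⊔ (x ⊓ S.inf id ⊓ (T \ S).inf id) := inf_sup_left _ _ _
      _ ≤ y := sup_le (inf_le_right.trans inf_le_right) (by rwa [inf_assoc, ← h2])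
  · rintro ⟨hS, h⟩
    exact (inf_le_inf_left _ (Finset.inf_mono hS)).trans h

theorem sum_superset_pow_mul_pow (p : ℝ) {α : Type*} {S U : Finset α} (h : S ⊆ U) :
    ∑ T ∈ U.powerset.filter (fun T => S ⊆ T), p ^ T.card * (1 - p) ^ (U.card - T.card) =
      p ^ S.card := by
  have key : ∑ T ∈ U.powerset.filter (fun T => S ⊆ T),
      p ^ T.card * (1 - p) ^ (U.card - T.card) =
      ∑ T ∈ (U \ S).powerset, p ^ S.card * (p ^ T.card * (1 - p) ^ ((U \ S).card - T.card)) := by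
    refine Finset.sum_bij' (fun T _ => T \ S) (fun T _ => S ∪ T) ?_ ?_ ?_ ?_ ?_
    · intro T hT
      simp only [Finset.mem_filter, Finset.mem_powerset] at hT ⊢
      exact Finset.sdiff_subset_sdiff hT.1 le_rfl
    · intro T hT
      simp only [Finset.mem_filter, Finset.mem_powerset] at hT ⊢
      exact ⟨Finset.union_subset h (hT.trans Finset.sdiff_subset), Finset.subset_union_left⟩
    · intro T hT
      exact Finset.union_sdiff_of_subset (Finset.mem_filter.1 hT).2
    · intro T hT
      exact Finset.union_sdiff_cancel_left
        (Finset.disjoint_of_subset_right (Finset.mem_powerset.1 hT) Finset.disjoint_sdiff)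
    · intro T hT
      simp only [Finset.mem_filter, Finset.mem_powerset] at hT
      have h1 := Finset.card_sdiff_add_card_eq_card hT.2
      have h2 := Finset.card_sdiff_add_card_eq_card h
      rw [← mul_assoc, ← pow_add, add_comm S.card, h1]
      congr 2
      omega
  rw [key, ← Finset.mul_sum, Finset.sum_pow_mul_eq_add_pow]
  simp

/-- The probability that one step of the chain from `x` ends below `y`. -/
theorem sum_ungarP_le (p : ℝ) (x y : L) :
    ∑ z, ungarP p x z * (if z ≤ y then 1 else 0) =
      if x ⊓ (ungarCovAbove x y).inf id ≤ y then p ^ (ungarCovAbove x y).card else 0 := by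
  rw [sum_ungarP_mul]
  simp only [mul_ite, mul_one, mul_zero]
  rw [← Finset.sum_filter]
  split_ifs with h
  · have hsub : ungarCovAbove x y ⊆ ungarCov x := Finset.filter_subset _ _
    rw [← sum_superset_pow_mul_pow p hsub]
    refine Finset.sum_congr (Finset.filter_congr fun T hT => ?_) fun _ _ => rfl
    rw [inf_finset_inf_le_iff (Finset.mem_powerset.1 hT), and_iff_left h]
  · rw [Finset.filter_false_of_mem, Finset.sum_empty]
    intro T hT hle
    exact h ((inf_finset_inf_le_iff (Finset.mem_powerset.1 hT)).1 hle).2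

open OrderDual

theorem mem_ungarCovAbove_toDual {L : Type*} [Fintype L] [Lattice L] {x y c : L} :
    toDual c ∈ ungarCovAbove (toDual y) (toDual x) ↔ y ⋖ c ∧ c ≤ y ⊔ x := by
  rw [mem_ungarCovAbove, toDual_covBy_toDual_iff, ← _root_.toDual_sup, toDual_le_toDual]

theorem ungarCovAbove_dual {x y : L} (h : x ⊓ (ungarCovAbove x y).inf id ≤ y) :
    toDual y ⊓ (ungarCovAbove (toDual y) (toDual x)).inf id ≤ toDual x ∧
      (ungarCovAbove x y).card ≤ (ungarCovAbove (toDual y) (toDual x)).card := by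
  set S := ungarCovAbove x y with hS
  -- `a c` is the complement of `c` in the interval from `x ⊓ y` to `x`
  let a : L → L := fun c => x ⊓ (S.erase c).inf id
  have a_le : ∀ c, a c ≤ x := fun c => inf_le_left
  have le_a : ∀ c, x ⊓ y ≤ a c := fun c => le_inf inf_le_left <|
    Finset.le_inf fun d hd => (mem_ungarCovAbove.1 (Finset.mem_of_mem_erase hd)).2
  have a_sup : ∀ c ∈ S, a c ⊔ c = x := by
    intro c hc
    have hcx := (mem_ungarCovAbove.1 hc).1
    refine le_antisymm (sup_le (a_le c) hcx.le) ?_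
    have h1 : x ≤ c ⊔ (S.erase c).inf id := le_sup_finset_inf fun d hd =>
      (hcx.wcovBy.sup_eq (mem_ungarCovAbove.1 (Finset.mem_of_mem_erase hd)).1.wcovBy
        (Finset.ne_of_mem_erase hd).symm).ge
    rw [sup_comm, sup_inf_left]
    exact le_inf le_sup_right h1
  have a_not_le : ∀ c ∈ S, ¬ a c ≤ c := by
    intro c hc hle
    have h1 := a_sup c hc
    rw [sup_eq_right.2 hle] at h1
    exact (mem_ungarCovAbove.1 hc).1.ne h1
  have a_inf : ∀ c ∈ S, a c ⊓ c = x ⊓ y := by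
    intro c hc
    refine le_antisymm (le_inf (inf_le_left.trans (a_le c)) ?_)
      (le_inf (le_a c) (mem_ungarCovAbove.1 hc).2)
    refine le_trans ?_ h
    conv_rhs => rw [← Finset.insert_erase hc, Finset.inf_insert]
    exact le_inf (inf_le_left.trans (a_le c))
      (le_inf (inf_le_right : a c ⊓ c ≤ c) (inf_le_left.trans inf_le_right))
  have mem : ∀ c ∈ S, toDual (a c ⊔ y) ∈ ungarCovAbove (toDual y) (toDual x) := by
    intro c hc
    rw [mem_ungarCovAbove_toDual]
    refine ⟨?_, sup_le ((a_le c).trans le_sup_right) le_sup_left⟩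
    have h1 : a c ⊓ c ⋖ a c := by
      apply CovBy.inf_of_sup_right
      rw [a_sup c hc]
      exact (mem_ungarCovAbove.1 hc).1
    have h2 : a c ⊓ y = a c ⊓ c := by
      rw [a_inf c hc]
      exact le_antisymm (inf_le_inf_right _ (a_le c)) (le_inf (le_a c) inf_le_right)
    rw [← h2] at h1
    exact h1.sup_of_inf_left
  constructor
  · set S' := ungarCovAbove (toDual y) (toDual x)
    let m : L := ofDual (toDual y ⊓ S'.inf id)
    have hym : y ≤ m := toDual_le_toDual.1 (inf_le_left : toDual y ⊓ S'.inf id ≤ toDual y)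
    change x ≤ m
    by_contra hxm
    have hlt : x ⊓ m < x := lt_of_le_of_ne inf_le_left fun e => hxm (inf_eq_left.1 e)
    obtain ⟨c, hmc, hcx⟩ := exists_le_covBy_of_lt hlt
    have hc : c ∈ S := mem_ungarCovAbove.2 ⟨hcx, (inf_le_inf_left x hym).trans hmc⟩
    have hle : toDual y ⊓ S'.inf id ≤ toDual (a c ⊔ y) :=
      inf_le_right.trans (Finset.inf_le (f := id) (mem c hc))
    have hle' : a c ⊔ y ≤ m := hle
    exact a_not_le c hc ((le_inf (a_le c) (le_sup_left.trans hle')).trans hmc)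
  · refine Finset.card_le_card_of_injOn (fun c => toDual (a c ⊔ y)) mem ?_
    intro c hc d hd hcd
    have hcd' : a c ⊔ y = a d ⊔ y := toDual.injective hcd
    by_contra hne
    have h1 : a d ≤ c := inf_le_right.trans
      (Finset.inf_le (f := id) (Finset.mem_erase.2 ⟨hne, hc⟩))
    refine a_not_le c hc ?_
    calc a c ≤ x ⊓ (a d ⊔ y) := le_inf (a_le c) (hcd' ▸ le_sup_left)
      _ = (x ⊓ a d) ⊔ (x ⊓ y) := inf_sup_left _ _ _
      _ ≤ c := sup_le (inf_le_right.trans h1) (mem_ungarCovAbove.1 hc).2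

/-- Siegmund duality between the Ungarian Markov chains of `L` and `Lᵒᵈ`. -/
theorem sum_ungarP_le_dual (p : ℝ) (x y : L) :
    ∑ z, ungarP p x z * (if z ≤ y then 1 else 0) =
      ∑ z, ungarP p (toDual y) z * (if z ≤ toDual x then 1 else 0) := by
  rw [sum_ungarP_le, sum_ungarP_le]
  have dual := ungarCovAbove_dual (x := toDual y) (y := toDual x)
  by_cases h : x ⊓ (ungarCovAbove x y).inf id ≤ y
  · obtain ⟨h', hle⟩ := ungarCovAbove_dual h
    rw [if_pos h, if_pos h', le_antisymm hle (dual h').2]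
  · rw [if_neg h, if_neg fun h' => h (dual h').1]

open Matrix in
theorem ungarMatrix_pow_dual [DecidableEq L] [DecidableEq Lᵒᵈ] (p : ℝ) (n : ℕ) :
    (ungarMatrix Lᵒᵈ p ^ n) ⊤ ⊥ = (ungarMatrix L p ^ n) ⊤ ⊥ := by
  let H : Matrix L Lᵒᵈ ℝ := Matrix.of fun x y => if x ≤ ofDual y then 1 else 0
  have comm : ungarMatrix L p * H = H * (ungarMatrix Lᵒᵈ p)ᵀ := by
    ext x y
    simp only [Matrix.mul_apply, Matrix.transpose_apply, ungarMatrix, H, Matrix.of_apply]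
    refine (sum_ungarP_le_dual p x (ofDual y)).trans (Finset.sum_congr rfl fun z _ => ?_)
    rw [mul_comm]
    rfl
  have comm_pow : ungarMatrix L p ^ n * H = H * (ungarMatrix Lᵒᵈ p ^ n)ᵀ := by
    induction n with
    | zero => simp
    | succ n ih =>
      rw [pow_succ, Matrix.mul_assoc, comm, ← Matrix.mul_assoc, ih, Matrix.mul_assoc,
        ← Matrix.transpose_mul, ← pow_succ']
  have h := congrFun (congrFun comm_pow ⊤) ⊤
  simp only [Matrix.mul_apply, Matrix.transpose_apply, H, Matrix.of_apply, ofDual_top, le_bot_iff,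
    top_le_iff, ofDual_eq_top, mul_ite, ite_mul, mul_one, one_mul, mul_zero, zero_mul,
    Finset.sum_ite_eq', Finset.mem_univ, if_true] at h
  exact h.symm

end Duality

/-- For a finite distributive lattice `L` and its dual `Lᵒᵈ`, the
expected top-to-bottom absorption times of the Ungarian Markov chains coincide:
`𝓔(Lᵒᵈ) = 𝓔(L)`. -/
theorem stmt_7 {L : Type*} [Fintype L] [DistribLattice L] [BoundedOrder L]
    (p : ℝ) (hp : 0 < p) (hp1 : p ≤ 1)
    (E : L → ℝ) (hE : IsUngarExp p E)
    (E' : Lᵒᵈ → ℝ) (hE' : IsUngarExp p E') :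
    E' ⊤ = E ⊤ := by
  refine tendsto_nhds_unique ((hE'.tendsto_sum hp.le hp1 ⊤).congr fun N => ?_)
    (hE.tendsto_sum hp.le hp1 ⊤)
  exact Finset.sum_congr rfl fun n _ => by rw [ungarMatrix_pow_dual]
end

section
/- Fix $p \in (0,1)$. The expected number of steps $\mathcal{E}(S_n)$ of the Ungarian Markov chain on the weak order of the symmetric group $S_n$ to go from the decreasing permutation $n(n-1)\cdots 1$ to the identity satisfies the recursive lower bound derived from Ungar's theorem, yielding $\mathcal{E}(S_n) \geq n - 2 + \frac{1 - p^{n-1}(n-2)}{1-(1-p)^{n-1}}$ for $n \geq 4$; in particular $\mathcal{E}(S_n) \geq n - 1 + o(1)$ as $n \to \infty$. -/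
open Finset Equiv
open scoped Classical

/-- The start of the maximal block of consecutive positions in `T` below `i`. -/
noncomputable def blockStart {m : ℕ} (T : Finset (Fin m)) (i : Fin (m + 1)) : ℕ :=
  sInf {a : ℕ | a ≤ i.val ∧ ∀ k : Fin m, a ≤ k.val → k.val < i.val → k ∈ T}

/-- The end of the maximal block of consecutive positions in `T` above `i`. -/
noncomputable def blockEnd {m : ℕ} (T : Finset (Fin m)) (i : Fin (m + 1)) : ℕ :=
  sSup {b : ℕ | b ≤ m ∧ i.val ≤ b ∧ ∀ k : Fin m, i.val ≤ k.val → k.val < b → k ∈ T}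

/-- The descent set of a permutation of `{0, …, m}`. -/
def Des {m : ℕ} (x : Equiv.Perm (Fin (m + 1))) : Finset (Fin m) :=
  Finset.univ.filter (fun i => x i.succ < x i.castSucc)

/-- `y` is the result of applying the Ungar move determined by `T ⊆ Des x` to `x`:
each maximal consecutive decreasing run of `x` supported on the positions in `T`
is reversed. -/
def IsUngarMoveTo {m : ℕ} (x : Equiv.Perm (Fin (m + 1))) (T : Finset (Fin m))
    (y : Equiv.Perm (Fin (m + 1))) : Prop :=
  ∀ i j : Fin (m + 1), (j : ℕ) = blockStart T i + blockEnd T i - (i : ℕ) → y i = x j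

/-- Transition probabilities of the Ungarian Markov chain `𝐔_{S_n}` on the weak order
of the symmetric group: from `x`, choose a random subset `T ⊆ Des x` (each descent
included independently with probability `p`) and apply the corresponding Ungar move. -/
noncomputable def weakP {m : ℕ} (p : ℝ) (x y : Equiv.Perm (Fin (m + 1))) : ℝ :=
  ∑ T ∈ (Des x).powerset.filter (fun T => IsUngarMoveTo x T y),
    p ^ T.card * (1 - p) ^ ((Des x).card - T.card)

/-- `E` is the expected-number-of-steps-to-the-identity function of `𝐔_{S_n}`. -/
def IsWeakOrderExp {m : ℕ} (p : ℝ) (E : Equiv.Perm (Fin (m + 1)) → ℝ) : Prop :=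
  E 1 = 0 ∧ ∀ x : Equiv.Perm (Fin (m + 1)), x ≠ 1 →
    E x = 1 + ∑ y : Equiv.Perm (Fin (m + 1)), weakP p x y * E y

/-- `τ a b` is the time at which the letters `a` and `b` are exchanged, in a sequence of `t`
block reversals taking the decreasing permutation to the increasing one. -/
structure IsSwapTime {N : ℕ} (t : ℕ) (τ : Fin N → Fin N → ℕ) : Prop where
  symm : ∀ a b, τ a b = τ b a
  lt : ∀ a b, a ≠ b → τ a b < t
  triple : ∀ a b c, a < b → b < c → (τ a b = τ a c ∧ τ a c = τ b c) ∨
    (τ a b < τ a c ∧ τ a c < τ b c) ∨ (τ b c < τ a c ∧ τ a c < τ a b)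

namespace IsSwapTime

variable {N t : ℕ} {τ : Fin N → Fin N → ℕ}

/-- The letter `a` precedes the letter `b` at time `k`. -/
def Before (τ : Fin N → Fin N → ℕ) (k : ℕ) (a b : Fin N) : Prop :=
  (a < b ∧ τ a b < k) ∨ (b < a ∧ k ≤ τ a b)

/-- The position of the letter `a` at time `k`. -/
noncomputable def pos (τ : Fin N → Fin N → ℕ) (k : ℕ) (a : Fin N) : ℕ :=
  #{b | Before τ k b a}

lemma not_before_self (k : ℕ) (a : Fin N) : ¬ Before τ k a a := by
  simp [Before]

lemma before_ne {k : ℕ} {a b : Fin N} (h : Before τ k a b) : a ≠ b := by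
  rintro rfl
  exact not_before_self _ _ h

lemma before_total (hτ : IsSwapTime t τ) (k : ℕ) {a b : Fin N} (h : a ≠ b) :
    Before τ k a b ∨ Before τ k b a := by
  have := hτ.symm a b
  unfold Before
  rcases lt_or_gt_of_ne h with h | h <;> omega

lemma before_asymm (hτ : IsSwapTime t τ) {k : ℕ} {a b : Fin N} (h : Before τ k a b) :
    ¬ Before τ k b a := by
  have := hτ.symm a b
  unfold Before at *
  omega

lemma before_trans (hτ : IsSwapTime t τ) {k : ℕ} {a b c : Fin N} (hab : Before τ k a b)
    (hbc : Before τ k b c) : Before τ k a c := by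
  have h1 := hτ.symm a b
  have h2 := hτ.symm b c
  have h3 := hτ.symm a c
  have t1 := hτ.triple a b c
  have t2 := hτ.triple a c b
  have t3 := hτ.triple b a c
  have t4 := hτ.triple b c a
  have t5 := hτ.triple c a b
  have t6 := hτ.triple c b a
  have hac : a ≠ c := by
    rintro rfl
    exact before_asymm hτ hab hbc
  unfold Before at *
  rcases lt_or_gt_of_ne hac with h | h <;> rcases hab with hab | hab <;>
    rcases hbc with hbc | hbc <;> omega

lemma swap_of_between (hτ : IsSwapTime t τ) {k s : ℕ} (hs : s = k ∨ s = k + 1) {a b c : Fin N}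
    (hab : Before τ s a b) (hbc : Before τ s b c) (h : τ a c = k) : τ a b = k ∧ τ b c = k := by
  have h1 := hτ.symm a b
  have h2 := hτ.symm b c
  have h3 := hτ.symm a c
  have t1 := hτ.triple a b c
  have t2 := hτ.triple a c b
  have t3 := hτ.triple b a c
  have t4 := hτ.triple b c a
  have t5 := hτ.triple c a b
  have t6 := hτ.triple c b a
  have hac := before_trans hτ hab hbc
  unfold Before at *
  rcases hab with hab | hab <;> rcases hbc with hbc | hbc <;> omega

lemma before_iff_pos_lt (hτ : IsSwapTime t τ) {k : ℕ} {a b : Fin N} :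
    Before τ k a b ↔ pos τ k a < pos τ k b := by
  have key : ∀ a b, Before τ k a b → pos τ k a < pos τ k b := by
    intro a b h
    apply Finset.card_lt_card
    rw [Finset.ssubset_iff_of_subset]
    · exact ⟨a, by simpa using h, by simpa using not_before_self k a⟩
    · intro c hc
      simp only [mem_filter, mem_univ, true_and] at hc ⊢
      exact before_trans hτ hc h
  refine ⟨key a b, fun h => ?_⟩
  by_contra hn
  rcases eq_or_ne a b with rfl | hne
  · exact lt_irrefl _ h
  · have := key b a ((before_total hτ k hne).resolve_left hn)
    omega

lemma pos_injective (hτ : IsSwapTime t τ) (k : ℕ) : Function.Injective (pos τ k) := by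
  intro a b h
  by_contra hne
  rcases before_total hτ k hne with h' | h' <;> rw [before_iff_pos_lt hτ] at h' <;> omega

lemma pos_lt (k : ℕ) (a : Fin N) : pos τ k a < N := by
  have : pos τ k a < #(univ : Finset (Fin N)) := by
    apply Finset.card_lt_card
    rw [Finset.ssubset_iff_of_subset (Finset.subset_univ _)]
    exact ⟨a, mem_univ _, by simpa using not_before_self k a⟩
  simpa using this

lemma exists_pos_eq (hτ : IsSwapTime t τ) (k : ℕ) {x : ℕ} (hx : x < N) :
    ∃ a, pos τ k a = x := by
  have hinj : Function.Injective (fun a : Fin N => (⟨pos τ k a, pos_lt k a⟩ : Fin N)) := by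
    intro a b h
    exact pos_injective hτ k (by simpa using h)
  obtain ⟨a, ha⟩ := (Finite.injective_iff_surjective.mp hinj) ⟨x, hx⟩
  exact ⟨a, by simpa using ha⟩

lemma card_pos_mem (hτ : IsSwapTime t τ) (k : ℕ) (s : Finset ℕ) (hs : ∀ x ∈ s, x < N) :
    #{a | pos τ k a ∈ s} = #s := by
  rw [← Finset.card_image_of_injective _ (pos_injective hτ k)]
  congr 1
  ext x
  simp only [mem_image, mem_filter, mem_univ, true_and]
  constructor
  · rintro ⟨a, ha, rfl⟩
    exact ha
  · intro hx
    obtain ⟨a, rfl⟩ := exists_pos_eq hτ k (hs x hx)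
    exact ⟨a, hx, rfl⟩

lemma pos_zero (a : Fin N) : pos τ 0 a + a + 1 = N := by
  have : pos τ 0 a = #(Finset.Ioi a) := by
    unfold pos Before
    congr 1
    ext b
    simp
  rw [this, Fin.card_Ioi]
  omega

lemma pos_final (hτ : IsSwapTime t τ) (a : Fin N) : pos τ t a = a := by
  have : pos τ t a = #(Finset.Iio a) := by
    unfold pos Before
    congr 1
    ext b
    simp only [mem_filter, mem_univ, true_and, mem_Iio]
    constructor
    · rintro (h | h)
      · exact h.1
      · exact absurd (hτ.lt b a (ne_of_gt h.1)) (by omega)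
    · intro h
      exact Or.inl ⟨h, hτ.lt b a (ne_of_lt h)⟩
  rw [this, Fin.card_Iio]

lemma before_succ {k : ℕ} {a b : Fin N} (h : τ a b ≠ k) :
    Before τ (k + 1) a b ↔ Before τ k a b := by
  unfold Before
  omega

lemma pos_succ {k : ℕ} {a : Fin N} (h : ∀ b, b ≠ a → τ b a ≠ k) :
    pos τ (k + 1) a = pos τ k a := by
  unfold pos
  congr 1
  ext b
  simp only [mem_filter, mem_univ, true_and]
  rcases eq_or_ne b a with rfl | hne
  · simp [not_before_self]
  · exact before_succ (h b hne)

/-- The letter `a` is among the `2 * d` letters closest to the middle of the `2 * h` positions. -/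
def Central (τ : Fin N → Fin N → ℕ) (h k d : ℕ) (a : Fin N) : Prop :=
  h ≤ pos τ k a + d ∧ pos τ k a < h + d

/-- All pairs of the `2 * d` central letters at time `k` are exchanged at time `c`. -/
def CentralSwap (τ : Fin N → Fin N → ℕ) (h k d c : ℕ) : Prop :=
  ∀ a b, a ≠ b → Central τ h k d a → Central τ h k d b → τ a b = c

variable {h : ℕ} {τ : Fin (2 * h) → Fin (2 * h) → ℕ}

lemma CentralSwap.swap_ne (hτ : IsSwapTime t τ) {k s d c : ℕ} (hs : s = k ∨ s = k + 1)
    (hkc : k ≠ c) (hd : d + 1 ≤ h) (hP : CentralSwap τ h s (d + 1) c) {a b : Fin (2 * h)}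
    (ha : Central τ h s d a) (hba : b ≠ a) : τ b a ≠ k := by
  intro hk
  unfold Central at ha
  rcases before_total hτ s hba with hlt | hlt
  · obtain ⟨a', ha'⟩ := exists_pos_eq hτ s (x := pos τ s a - 1) (by omega)
    have hlt' : Before τ s a' a := by rw [before_iff_pos_lt hτ]; omega
    have hc := hP a' a (before_ne hlt') (by unfold Central; omega) (by unfold Central; omega)
    rcases eq_or_ne b a' with rfl | hne
    · omega
    · have hlt'' : Before τ s b a' := by
        rw [before_iff_pos_lt hτ] at hlt ⊢
        have := (pos_injective hτ s).ne hne
        omega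
      have := (swap_of_between hτ hs hlt'' hlt' hk).2
      omega
  · obtain ⟨a', ha'⟩ := exists_pos_eq hτ s (x := pos τ s a + 1) (by omega)
    have hlt' : Before τ s a a' := by rw [before_iff_pos_lt hτ]; omega
    have hc := hP a a' (before_ne hlt') (by unfold Central; omega) (by unfold Central; omega)
    rcases eq_or_ne b a' with rfl | hne
    · have := hτ.symm a b
      omega
    · have hlt'' : Before τ s a' b := by
        rw [before_iff_pos_lt hτ] at hlt ⊢
        have := (pos_injective hτ s).ne hne
        omega
      have := (swap_of_between hτ hs hlt' hlt'' (by rw [hτ.symm]; exact hk)).1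
      omega

lemma CentralSwap.succ (hτ : IsSwapTime t τ) {k d c : ℕ} (hkc : k ≠ c) (hd : d + 1 ≤ h)
    (hP : CentralSwap τ h k (d + 1) c) : CentralSwap τ h (k + 1) d c := by
  have key : ∀ a, Central τ h (k + 1) d a → Central τ h k (d + 1) a := by
    intro a ha
    obtain ⟨a', ha'⟩ := exists_pos_eq hτ k (pos_lt (τ := τ) (k + 1) a)
    have hc : Central τ h k d a' := by unfold Central at *; omega
    have h1 := pos_succ (τ := τ) fun b hb => hP.swap_ne hτ (Or.inl rfl) hkc hd hc hb
    have : a' = a := pos_injective hτ (k + 1) (by omega)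
    subst this
    unfold Central at *
    omega
  intro a b hab ha hb
  exact hP a b hab (key a ha) (key b hb)

lemma CentralSwap.pred (hτ : IsSwapTime t τ) {k d c : ℕ} (hkc : k ≠ c) (hd : d + 1 ≤ h)
    (hP : CentralSwap τ h (k + 1) (d + 1) c) : CentralSwap τ h k d c := by
  have key : ∀ a, Central τ h k d a → Central τ h (k + 1) (d + 1) a := by
    intro a ha
    obtain ⟨a', ha'⟩ := exists_pos_eq hτ (k + 1) (pos_lt (τ := τ) k a)
    have hc : Central τ h (k + 1) d a' := by unfold Central at *; omega
    have h1 := pos_succ (τ := τ) fun b hb => hP.swap_ne hτ (Or.inr rfl) hkc hd hc hb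
    have : a' = a := pos_injective hτ k (by omega)
    subst this
    unfold Central at *
    omega
  intro a b hab ha hb
  exact hP a b hab (key a ha) (key b hb)

lemma CentralSwap.zero (k c : ℕ) : CentralSwap τ h k 0 c := by
  intro a b _ ha _
  unfold Central at ha
  omega

lemma CentralSwap.forward (hτ : IsSwapTime t τ) {k d c : ℕ} (hd : d ≤ h)
    (hP : CentralSwap τ h k d c) (j : ℕ) (hj : ∀ i, k ≤ i → i < k + j → i ≠ c) :
    CentralSwap τ h (k + j) (d - j) c := by
  induction j with
  | zero => exact hP
  | succ j ih =>
    have ih := ih fun i h1 h2 => hj i h1 (by omega)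
    rcases Nat.eq_zero_or_pos (d - j) with h0 | h0
    · rw [show d - (j + 1) = 0 by omega]
      exact CentralSwap.zero _ _
    · rw [show d - j = (d - (j + 1)) + 1 by omega] at ih
      exact ih.succ hτ (hj (k + j) (by omega) (by omega)) (by omega)

lemma CentralSwap.backward (hτ : IsSwapTime t τ) {k d c : ℕ} (hd : d ≤ h) (j : ℕ)
    (hP : CentralSwap τ h (k + j) d c) (hj : ∀ i, k ≤ i → i < k + j → i ≠ c) :
    CentralSwap τ h k (d - j) c := by
  induction j generalizing d with
  | zero => exact hP
  | succ j ih =>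
    rcases Nat.eq_zero_or_pos d with h0 | h0
    · rw [show d - (j + 1) = 0 by omega]
      exact CentralSwap.zero _ _
    · obtain ⟨d, rfl⟩ : ∃ d', d = d' + 1 := ⟨d - 1, by omega⟩
      have := ih (by omega) (hP.pred (k := k + j) hτ (hj _ (by omega) (by omega)) (by omega))
        fun i h1 h2 => hj i h1 (by omega)
      rwa [show d + 1 - (j + 1) = d - j by omega]

lemma CentralSwap.unique (hτ : IsSwapTime t τ) {k d c d' c' : ℕ} (hh : 0 < h) (hd : 0 < d)
    (hd' : 0 < d') (hP : CentralSwap τ h k d c) (hP' : CentralSwap τ h k d' c') : c = c' := by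
  obtain ⟨a, ha⟩ := exists_pos_eq hτ k (x := h - 1) (by omega)
  obtain ⟨b, hb⟩ := exists_pos_eq hτ k (x := h) (by omega)
  have hab : a ≠ b := by
    rintro rfl
    omega
  rw [← hP a b hab (by unfold Central; omega) (by unfold Central; omega)]
  exact hP' a b hab (by unfold Central; omega) (by unfold Central; omega)

lemma centralSwap_zero_iff (hτ : IsSwapTime t τ) {d c : ℕ} :
    CentralSwap τ h 0 d c ↔ CentralSwap τ h t d c := by
  have key : ∀ a, Central τ h 0 d a ↔ Central τ h t d a := by
    intro a
    have h0 := pos_zero (τ := τ) a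
    have h1 := pos_final hτ a
    unfold Central
    omega
  unfold CentralSwap
  simp only [key]

/-- The letters which move from the right half to the left half at time `k`. -/
noncomputable def crossing (τ : Fin (2 * h) → Fin (2 * h) → ℕ) (k : ℕ) : Finset (Fin (2 * h)) :=
  {a | h ≤ pos τ k a ∧ pos τ (k + 1) a < h}

/-- The letters which move from the left half to the right half at time `k`. -/
noncomputable def cocrossing (τ : Fin (2 * h) → Fin (2 * h) → ℕ) (k : ℕ) : Finset (Fin (2 * h)) :=
  {a | pos τ k a < h ∧ h ≤ pos τ (k + 1) a}

lemma card_right (hτ : IsSwapTime t τ) (k : ℕ) : #{a | h ≤ pos τ k a} = h := by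
  have := card_pos_mem hτ k (Finset.Ico h (2 * h)) (by simp)
  rw [Nat.card_Ico] at this
  refine Eq.trans ?_ (this.trans (by omega))
  congr 1
  ext a
  have := pos_lt (τ := τ) k a
  simp
  omega

lemma card_cocrossing (hτ : IsSwapTime t τ) (k : ℕ) : #(cocrossing τ k) = #(crossing τ k) := by
  have h1 := card_right hτ k
  have h2 := card_right hτ (k + 1)
  have e1 : cocrossing τ k =
      ({a | h ≤ pos τ (k + 1) a} : Finset (Fin (2 * h))) \ ({a | h ≤ pos τ k a} : Finset _) := by
    ext a
    simp [cocrossing, and_comm]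
  have e2 : crossing τ k =
      ({a | h ≤ pos τ k a} : Finset (Fin (2 * h))) \ ({a | h ≤ pos τ (k + 1) a} : Finset _) := by
    ext a
    simp [crossing]
  rw [e1, e2]
  exact Finset.card_sdiff_comm (h2.trans h1.symm)

lemma card_crossing_le (hτ : IsSwapTime t τ) (k : ℕ) : #(crossing τ k) ≤ h := by
  conv_rhs => rw [← card_right hτ k]
  apply Finset.card_le_card
  intro a
  simp only [crossing, mem_filter, mem_univ, true_and]
  exact fun h => h.1

lemma exists_far_right (hτ : IsSwapTime t τ) (s : ℕ) (S : Finset (Fin (2 * h)))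
    (hS : ∀ a ∈ S, h ≤ pos τ s a) (h0 : 0 < #S) : ∃ a ∈ S, h + #S ≤ pos τ s a + 1 := by
  by_contra! hc
  have : #(S.image (pos τ s)) ≤ #(Finset.Ico h (h + #S - 1)) := by
    apply Finset.card_le_card
    intro x hx
    simp only [mem_image] at hx
    obtain ⟨a, ha, rfl⟩ := hx
    have := hS a ha
    have := hc a ha
    simp
    omega
  rw [Finset.card_image_of_injective _ (pos_injective hτ s), Nat.card_Ico] at this
  omega

lemma exists_far_left (hτ : IsSwapTime t τ) (s : ℕ) (S : Finset (Fin (2 * h)))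
    (hS : ∀ a ∈ S, pos τ s a < h) (h0 : 0 < #S) : ∃ a ∈ S, pos τ s a + #S ≤ h := by
  by_contra! hc
  have : #(S.image (pos τ s)) ≤ #(Finset.Ico (h + 1 - #S) h) := by
    apply Finset.card_le_card
    intro x hx
    simp only [mem_image] at hx
    obtain ⟨a, ha, rfl⟩ := hx
    have := hS a ha
    have := hc a ha
    simp
    omega
  rw [Finset.card_image_of_injective _ (pos_injective hτ s), Nat.card_Ico] at this
  omega

lemma centralSwap_of_sets (hτ : IsSwapTime t τ) {k s : ℕ} (hs : s = k ∨ s = k + 1)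
    (L R : Finset (Fin (2 * h))) (hL : ∀ a ∈ L, pos τ s a < h) (hR : ∀ a ∈ R, h ≤ pos τ s a)
    (hLR : #L = #R) (hk : ∀ a ∈ L, ∀ b ∈ R, τ a b = k) : CentralSwap τ h s #L k := by
  rcases Nat.eq_zero_or_pos #L with h0 | h0
  · rw [h0]
    exact CentralSwap.zero _ _
  obtain ⟨l, hl, hl'⟩ := exists_far_left hτ s L hL h0
  obtain ⟨r, hr, hr'⟩ := exists_far_right hτ s R hR (by omega)
  have hlr := hk l hl r hr
  have key : ∀ a b, Before τ s a b → Central τ h s #L a → Central τ h s #L b → τ a b = k := by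
    intro a b hab ha hb
    unfold Central at ha hb
    have har : τ a r = k := by
      rcases eq_or_ne l a with rfl | hne
      · exact hlr
      · have h1 := (pos_injective hτ s).ne hne
        have h2 := (before_iff_pos_lt hτ).mp hab
        refine (swap_of_between hτ hs (a := l) ?_ ?_ hlr).2 <;> rw [before_iff_pos_lt hτ] <;> omega
    rcases eq_or_ne b r with rfl | hne
    · exact har
    · have h1 := (pos_injective hτ s).ne hne
      refine (swap_of_between hτ hs hab ?_ har).1
      rw [before_iff_pos_lt hτ]
      omega
  intro a b hab ha hb
  rcases before_total hτ s hab with h' | h'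
  · exact key a b h' ha hb
  · rw [hτ.symm]
    exact key b a h' hb ha

lemma swap_of_mem_crossing (hτ : IsSwapTime t τ) {k : ℕ} {a b : Fin (2 * h)}
    (ha : a ∈ cocrossing τ k) (hb : b ∈ crossing τ k) : τ a b = k := by
  simp only [crossing, cocrossing, mem_filter, mem_univ, true_and] at ha hb
  by_contra hne
  have := before_succ hne
  rw [before_iff_pos_lt hτ, before_iff_pos_lt hτ] at this
  omega

lemma centralSwap_crossing (hτ : IsSwapTime t τ) (k : ℕ) :
    CentralSwap τ h k #(crossing τ k) k := by
  rw [← card_cocrossing hτ]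
  refine centralSwap_of_sets hτ (Or.inl rfl) (cocrossing τ k) (crossing τ k) ?_ ?_
    (card_cocrossing hτ k) fun a ha b hb => swap_of_mem_crossing hτ ha hb
  · intro a ha
    simp only [cocrossing, mem_filter, mem_univ, true_and] at ha
    exact ha.1
  · intro a ha
    simp only [crossing, mem_filter, mem_univ, true_and] at ha
    exact ha.1

lemma centralSwap_crossing_succ (hτ : IsSwapTime t τ) (k : ℕ) :
    CentralSwap τ h (k + 1) #(crossing τ k) k := by
  refine centralSwap_of_sets hτ (Or.inr rfl) (crossing τ k) (cocrossing τ k) ?_ ?_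
    (card_cocrossing hτ k).symm fun a ha b hb => by
      rw [hτ.symm]; exact swap_of_mem_crossing hτ hb ha
  · intro a ha
    simp only [crossing, mem_filter, mem_univ, true_and] at ha
    exact ha.2
  · intro a ha
    simp only [cocrossing, mem_filter, mem_univ, true_and] at ha
    exact ha.2

lemma exists_mem_crossing (a : Fin (2 * h)) (h0 : h ≤ pos τ 0 a) :
    ∀ s, pos τ s a < h → ∃ k < s, a ∈ crossing τ k := by
  intro s
  induction s with
  | zero => intro hs; omega
  | succ s ih =>
    intro hs
    by_cases hc : pos τ s a < h
    · obtain ⟨k, hk, hk'⟩ := ih hc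
      exact ⟨k, by omega, hk'⟩
    · exact ⟨s, by omega, by simp [crossing]; omega⟩

lemma le_sum_card_crossing (hτ : IsSwapTime t τ) : h ≤ ∑ k ∈ range t, #(crossing τ k) := by
  have h1 : #{a : Fin (2 * h) | pos τ t a ∈ range h} = h := by
    rw [card_pos_mem hτ t (range h) (by simp; omega), card_range]
  calc h = _ := h1.symm
    _ ≤ #((range t).biUnion (crossing τ)) := by
        apply Finset.card_le_card
        intro a ha
        simp only [mem_filter, mem_univ, true_and, mem_range] at ha
        have h0 := pos_zero (τ := τ) a
        have h2 := pos_final hτ a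
        obtain ⟨k, hk, hk'⟩ := exists_mem_crossing a (by omega) t ha
        exact mem_biUnion.mpr ⟨k, mem_range.mpr hk, hk'⟩
    _ ≤ _ := Finset.card_biUnion_le

lemma crossing_separated (hτ : IsSwapTime t τ) (hh : 0 < h) {c c' : ℕ} (hcc : c < c')
    (hc : 0 < #(crossing τ c)) (hc' : 0 < #(crossing τ c')) :
    c + #(crossing τ c) + #(crossing τ c') ≤ c' := by
  by_contra! hlt
  have hj : min (c' - c - 1) (#(crossing τ c) - 1) ≤ c' - c - 1 := min_le_left _ _
  set j := min (c' - c - 1) (#(crossing τ c) - 1) with hjdef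
  have h1 := (centralSwap_crossing_succ hτ c).forward hτ (card_crossing_le hτ c) j
    fun i _ _ => by omega
  have h2 := centralSwap_crossing hτ c'
  rw [show c' = (c + 1 + j) + (c' - c - 1 - j) by omega] at h2
  have h3 := CentralSwap.backward hτ (card_crossing_le hτ _) _ h2
    fun i _ _ => by omega
  rw [show (c + 1 + j) + (c' - c - 1 - j) = c' by omega] at h3
  have := CentralSwap.unique hτ hh (by omega) (by omega) h1 h3
  omega

lemma crossing_separated_wrap (hτ : IsSwapTime t τ) (hh : 0 < h) {c c' : ℕ} (hcc : c < c')
    (hct : c' < t) (hc : 0 < #(crossing τ c)) (hc' : 0 < #(crossing τ c')) :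
    c' + #(crossing τ c) + #(crossing τ c') ≤ c + t := by
  by_contra! hlt
  have hd := card_crossing_le hτ c
  have hd' := card_crossing_le hτ c'
  have hf := centralSwap_crossing_succ hτ c'
  have hb := centralSwap_crossing hτ c
  set d := #(crossing τ c)
  set d' := #(crossing τ c')
  by_cases hv : t - c' - 1 < d'
  · have h1 := hf.forward hτ hd' (t - c' - 1) fun i _ _ => by omega
    rw [show c' + 1 + (t - c' - 1) = t by omega, ← centralSwap_zero_iff hτ] at h1
    set x := min c (d' - (t - c' - 1) - 1) with hx
    have h2 := h1.forward hτ (by omega) x fun i _ _ => by omega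
    rw [show c = 0 + x + (c - x) by omega] at hb
    have h3 := CentralSwap.backward hτ hd _ hb fun i _ _ => by omega
    have := CentralSwap.unique hτ hh (by omega) (by omega) h2 h3
    omega
  · rw [show c = 0 + c by omega] at hb
    have h1 := CentralSwap.backward hτ hd _ hb fun i _ _ => by omega
    rw [centralSwap_zero_iff hτ] at h1
    rw [show t = c' + d' + (t - c' - d') by omega] at h1
    have h2 := CentralSwap.backward hτ (by omega) _ h1 fun i _ _ => by omega
    have h3 := hf.forward hτ hd' (d' - 1) fun i _ _ => by omega
    rw [show c' + 1 + (d' - 1) = c' + d' by omega] at h3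
    have := CentralSwap.unique hτ hh (by omega) (by omega) h2 h3
    omega

theorem two_mul_le (hτ : IsSwapTime t τ)
    (hnc : ∃ a b c d, a ≠ b ∧ c ≠ d ∧ τ a b ≠ τ c d) : 2 * h ≤ t := by
  obtain ⟨a, b, a', b', hab, hab', hne⟩ := hnc
  have hh : 0 < h := by have := a.2; omega
  set K := (range t).filter fun k => 0 < #(crossing τ k) with hK
  have hsum : h ≤ ∑ k ∈ K, #(crossing τ k) := by
    rw [hK, Finset.sum_filter_of_ne]
    · exact le_sum_card_crossing hτ
    · intro k _ hk
      omega
  have hKne : K.Nonempty := by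
    by_contra hc
    rw [Finset.not_nonempty_iff_eq_empty] at hc
    rw [hc] at hsum
    simp at hsum
    omega
  have hmem : ∀ k ∈ K, k < t ∧ 0 < #(crossing τ k) := by
    intro k hk
    simpa [hK] using hk
  have hlo := K.min'_mem hKne
  have hhi := K.max'_mem hKne
  set lo := K.min' hKne with hlodef
  set hi := K.max' hKne with hhidef
  have hlt : lo < hi := by
    by_contra hge
    have hsing : K ⊆ {lo} := by
      intro k hk
      have h1 := K.min'_le k hk
      have h2 := K.le_max' k hk
      rw [mem_singleton]
      omega
    have h1 := hsum.trans (Finset.sum_le_sum_of_subset hsing)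
    rw [Finset.sum_singleton] at h1
    have hall : ∀ x, Central τ h lo #(crossing τ lo) x := by
      intro x
      have := pos_lt (τ := τ) lo x
      unfold Central
      omega
    have hP := centralSwap_crossing hτ lo
    exact hne ((hP a b hab (hall _) (hall _)).trans (hP a' b' hab' (hall _) (hall _)).symm)
  set I : ℕ → Finset ℤ := fun k =>
    Finset.Ico ((k : ℤ) - #(crossing τ k)) ((k : ℤ) + #(crossing τ k)) with hI
  have hdisj : (K : Set ℕ).PairwiseDisjoint I := by
    have key : ∀ k ∈ K, ∀ l ∈ K, k < l → Disjoint (I k) (I l) := by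
      intro k hk l hl hkl
      have := crossing_separated hτ hh hkl (hmem k hk).2 (hmem l hl).2
      rw [Finset.disjoint_left]
      intro x hx hx'
      simp only [hI, Finset.mem_Ico] at hx hx'
      omega
    intro k hk l hl hkl
    rcases lt_or_gt_of_ne hkl with h' | h'
    · exact key k hk l hl h'
    · exact (key l hl k hk h').symm
  have hcard : #(K.biUnion I) = ∑ k ∈ K, 2 * #(crossing τ k) := by
    rw [Finset.card_biUnion hdisj]
    apply Finset.sum_congr rfl
    intro k _
    rw [hI, Int.card_Ico]
    omega
  have hsub : K.biUnion I ⊆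
      Finset.Ico ((lo : ℤ) - #(crossing τ lo)) ((hi : ℤ) + #(crossing τ hi)) := by
    intro x hx
    obtain ⟨k, hk, hx⟩ := mem_biUnion.mp hx
    simp only [hI, Finset.mem_Ico] at hx ⊢
    have h1 := K.min'_le k hk
    have h2 := K.le_max' k hk
    rw [← hlodef] at h1
    rw [← hhidef] at h2
    constructor
    · rcases h1.eq_or_lt with h1 | h1
      · rw [h1]; exact hx.1
      · have := crossing_separated hτ hh h1 (hmem _ hlo).2 (hmem _ hk).2
        omega
    · rcases h2.eq_or_lt with h2 | h2
      · rw [← h2]; exact hx.2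
      · have := crossing_separated hτ hh h2 (hmem _ hk).2 (hmem _ hhi).2
        omega
  have hle := Finset.card_le_card hsub
  rw [hcard, ← Finset.mul_sum, Int.card_Ico] at hle
  have := crossing_separated_wrap hτ hh hlt (hmem _ hhi).1 (hmem _ hlo).2 (hmem _ hhi).2
  omega

/-- Ungar's theorem, in terms of exchange times of pairs of letters. -/
theorem le_of_not_const {m : ℕ} {τ : Fin (m + 1) → Fin (m + 1) → ℕ} (hm : 4 ≤ m + 1)
    (hτ : IsSwapTime t τ) (hnc : ∃ a b c d, a ≠ b ∧ c ≠ d ∧ τ a b ≠ τ c d) : m ≤ t := by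
  rcases Nat.even_or_odd' (m + 1) with ⟨h, hh | hh⟩
  · have : ∀ N, N = 2 * h → ∀ τ : Fin N → Fin N → ℕ, IsSwapTime t τ →
        (∃ a b c d, a ≠ b ∧ c ≠ d ∧ τ a b ≠ τ c d) → 2 * h ≤ t := by
      rintro N rfl τ hτ hnc
      exact hτ.two_mul_le hnc
    have := this _ hh τ hτ hnc
    omega
  · obtain rfl : m = 2 * h := by omega
    obtain ⟨a, b, c, d, hab, hcd, hne⟩ := hnc
    obtain ⟨j, hj⟩ : ∃ j, j ∉ ({a, b, c, d} : Finset (Fin (2 * h + 1))) := by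
      by_contra! hall
      have h1 := Finset.card_le_card (fun x _ => hall x : Finset.univ ⊆ _)
      have h2 := Finset.card_le_four (a := a) (b := b) (c := c) (d := d)
      rw [Finset.card_univ, Fintype.card_fin] at h1
      omega
    simp only [mem_insert, mem_singleton, not_or] at hj
    obtain ⟨a, rfl⟩ := Fin.exists_succAbove_eq (Ne.symm hj.1)
    obtain ⟨b, rfl⟩ := Fin.exists_succAbove_eq (Ne.symm hj.2.1)
    obtain ⟨c, rfl⟩ := Fin.exists_succAbove_eq (Ne.symm hj.2.2.1)
    obtain ⟨d, rfl⟩ := Fin.exists_succAbove_eq (Ne.symm hj.2.2.2)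
    have hτ' : IsSwapTime t fun x y => τ (j.succAbove x) (j.succAbove y) :=
      ⟨fun x y => hτ.symm _ _,
        fun x y hxy => hτ.lt _ _ (Fin.succAbove_right_injective.ne hxy),
        fun x y z hxy hyz => hτ.triple _ _ _ (Fin.strictMono_succAbove j hxy)
          (Fin.strictMono_succAbove j hyz)⟩
    exact hτ'.two_mul_le ⟨a, b, c, d, ne_of_apply_ne _ hab, ne_of_apply_ne _ hcd, hne⟩

end IsSwapTime

section UngarMove

variable {m : ℕ}

/-- The positions `i` and `j` lie in a common maximal block of consecutive positions in `T`. -/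
def SameBlock (T : Finset (Fin m)) (i j : Fin (m + 1)) : Prop :=
  ∀ k : Fin m, min i.val j.val ≤ k.val → k.val < max i.val j.val → k ∈ T

lemma SameBlock.symm {T : Finset (Fin m)} {i j : Fin (m + 1)} (h : SameBlock T i j) :
    SameBlock T j i :=
  fun k h1 h2 => h k (by omega) (by omega)

lemma SameBlock.trans {T : Finset (Fin m)} {i j l : Fin (m + 1)} (h : SameBlock T i j)
    (h' : SameBlock T j l) : SameBlock T i l := by
  intro k h1 h2
  by_cases hk : min i.val j.val ≤ k.val ∧ k.val < max i.val j.val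
  · exact h k hk.1 hk.2
  · exact h' k (by omega) (by omega)

lemma blockStart_spec (T : Finset (Fin m)) (i : Fin (m + 1)) :
    blockStart T i ≤ i.val ∧ ∀ k : Fin m, blockStart T i ≤ k.val → k.val < i.val → k ∈ T :=
  Nat.sInf_mem (s := {a : ℕ | a ≤ i.val ∧ ∀ k : Fin m, a ≤ k.val → k.val < i.val → k ∈ T})
    ⟨i.val, le_rfl, fun k h1 h2 => absurd h1 (by omega)⟩

lemma blockEnd_bddAbove (T : Finset (Fin m)) (i : Fin (m + 1)) :
    BddAbove {b : ℕ | b ≤ m ∧ i.val ≤ b ∧ ∀ k : Fin m, i.val ≤ k.val → k.val < b → k ∈ T} :=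
  ⟨m, fun _ hb => hb.1⟩

lemma blockEnd_spec (T : Finset (Fin m)) (i : Fin (m + 1)) :
    blockEnd T i ≤ m ∧ i.val ≤ blockEnd T i ∧
      ∀ k : Fin m, i.val ≤ k.val → k.val < blockEnd T i → k ∈ T :=
  Nat.sSup_mem
    (s := {b : ℕ | b ≤ m ∧ i.val ≤ b ∧ ∀ k : Fin m, i.val ≤ k.val → k.val < b → k ∈ T})
    ⟨i.val, by omega, le_rfl, fun k h1 h2 => absurd h1 (by omega)⟩
    (blockEnd_bddAbove T i)

lemma SameBlock.blockStart_eq {T : Finset (Fin m)} {i j : Fin (m + 1)} (h : SameBlock T i j) :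
    blockStart T i = blockStart T j := by
  have key : ∀ i j, SameBlock T i j → blockStart T i ≤ blockStart T j := by
    intro i j h
    have hi := blockStart_spec T i
    have hj := blockStart_spec T j
    by_cases hle : blockStart T j ≤ i.val
    · refine Nat.sInf_le ⟨hle, fun k h1 h2 => ?_⟩
      by_cases hk : k.val < j.val
      · exact hj.2 k h1 hk
      · exact h k (by omega) (by omega)
    · omega
  exact le_antisymm (key i j h) (key j i h.symm)

lemma SameBlock.blockEnd_eq {T : Finset (Fin m)} {i j : Fin (m + 1)} (h : SameBlock T i j) :
    blockEnd T i = blockEnd T j := by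
  have key : ∀ i j, SameBlock T i j → blockEnd T j ≤ blockEnd T i := by
    intro i j h
    have hi := blockEnd_spec T i
    have hj := blockEnd_spec T j
    by_cases hle : i.val ≤ blockEnd T j
    · refine le_csSup (blockEnd_bddAbove T i) ⟨hj.1, hle, fun k h1 h2 => ?_⟩
      by_cases hk : j.val ≤ k.val
      · exact hj.2.2 k hk h2
      · exact h k (by omega) (by omega)
    · omega
  exact le_antisymm (key j i h.symm) (key i j h)

/-- Reversal of all maximal blocks of consecutive positions in `T`. -/
noncomputable def blockFlip (T : Finset (Fin m)) (i : Fin (m + 1)) : Fin (m + 1) :=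
  ⟨blockStart T i + blockEnd T i - i, by
    have := blockStart_spec T i
    have := blockEnd_spec T i
    omega⟩

lemma blockFlip_add (T : Finset (Fin m)) (i : Fin (m + 1)) :
    (blockFlip T i : ℕ) + i = blockStart T i + blockEnd T i := by
  have := blockEnd_spec T i
  simp only [blockFlip]
  omega

lemma sameBlock_blockFlip (T : Finset (Fin m)) (i : Fin (m + 1)) :
    SameBlock T i (blockFlip T i) := by
  have hs := blockStart_spec T i
  have he := blockEnd_spec T i
  have := blockFlip_add T i
  intro k h1 h2
  by_cases hk : k.val < i.val
  · exact hs.2 k (by omega) hk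
  · exact he.2.2 k (by omega) (by omega)

lemma SameBlock.blockFlip_add_eq {T : Finset (Fin m)} {i j : Fin (m + 1)} (h : SameBlock T i j) :
    (blockFlip T i : ℕ) + i = blockFlip T j + j := by
  rw [blockFlip_add, blockFlip_add, h.blockStart_eq, h.blockEnd_eq]

lemma blockFlip_involutive (T : Finset (Fin m)) : Function.Involutive (blockFlip T) := by
  intro i
  have := (sameBlock_blockFlip T i).blockFlip_add_eq
  ext
  omega

lemma blockFlip_lt_of_not_sameBlock {T : Finset (Fin m)} {i j : Fin (m + 1)} (hij : i < j)
    (h : ¬ SameBlock T i j) : blockFlip T i < blockFlip T j := by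
  have hi := sameBlock_blockFlip T i
  have hj := sameBlock_blockFlip T j
  unfold SameBlock at h
  push Not at h
  obtain ⟨k, h1, h2, hk⟩ := h
  rw [Fin.lt_def] at hij ⊢
  have h3 : (blockFlip T i : ℕ) ≤ k := by
    by_contra hc
    exact hk (hi k (by omega) (by omega))
  have h4 : (k : ℕ) < blockFlip T j := by
    by_contra hc
    exact hk (hj k (by omega) (by omega))
  omega

lemma SameBlock.blockFlip_lt {T : Finset (Fin m)} {i j : Fin (m + 1)} (hij : i < j)
    (h : SameBlock T i j) : blockFlip T j < blockFlip T i := by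
  have := h.blockFlip_add_eq
  rw [Fin.lt_def] at *
  omega

/-- The result of applying the Ungar move determined by `T` to `x`. -/
noncomputable def ungarMove (x : Equiv.Perm (Fin (m + 1))) (T : Finset (Fin m)) :
    Equiv.Perm (Fin (m + 1)) :=
  (blockFlip_involutive T).toPerm.trans x

lemma ungarMove_apply (x : Equiv.Perm (Fin (m + 1))) (T : Finset (Fin m)) (i : Fin (m + 1)) :
    ungarMove x T i = x (blockFlip T i) := rfl

lemma ungarMove_symm_apply (x : Equiv.Perm (Fin (m + 1))) (T : Finset (Fin m))
    (a : Fin (m + 1)) : (ungarMove x T).symm a = blockFlip T (x.symm a) := rfl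

lemma isUngarMoveTo_iff (x : Equiv.Perm (Fin (m + 1))) (T : Finset (Fin m))
    (y : Equiv.Perm (Fin (m + 1))) : IsUngarMoveTo x T y ↔ ungarMove x T = y := by
  constructor
  · intro h
    ext1 i
    rw [ungarMove_apply, h i (blockFlip T i) rfl]
  · rintro rfl i j hj
    rw [ungarMove_apply]
    congr 1
    ext
    exact hj.symm

lemma SameBlock.apply_lt {x : Equiv.Perm (Fin (m + 1))} {T : Finset (Fin m)} (hT : T ⊆ Des x)
    {i j : Fin (m + 1)} (hij : i < j) (h : SameBlock T i j) : x j < x i := by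
  induction j using Fin.induction with
  | zero => exact absurd hij (Fin.not_lt_zero i)
  | succ k ih =>
    have hij' := Fin.lt_def.mp hij
    rw [Fin.val_succ] at hij'
    have hk : x k.succ < x k.castSucc := by
      have := hT (h k (by omega) (by simp))
      simpa [Des] using this
    rcases eq_or_ne i k.castSucc with rfl | hne
    · exact hk
    · have hne' : (i : ℕ) ≠ k := fun he => hne (Fin.ext (by simpa using he))
      refine hk.trans (ih (Fin.lt_def.mpr (by simp; omega)) fun l h1 h2 => h l ?_ ?_)
      · simp at *; omega
      · simp at *; omega

/-- The pair of letters `a`, `b` is out of order in `x`. -/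
def Inverted (x : Equiv.Perm (Fin (m + 1))) (a b : Fin (m + 1)) : Prop :=
  a < b ∧ x.symm b < x.symm a

lemma inverted_ungarMove_iff {x : Equiv.Perm (Fin (m + 1))} {T : Finset (Fin m)}
    (hT : T ⊆ Des x) {a b : Fin (m + 1)} :
    Inverted (ungarMove x T) a b ↔
      Inverted x a b ∧ ¬ SameBlock T (x.symm a) (x.symm b) := by
  unfold Inverted
  simp only [ungarMove_symm_apply]
  by_cases hab : a < b
  · simp only [hab, true_and]
    rcases lt_or_gt_of_ne (x.symm.injective.ne hab.ne) with h | h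
    · have hns : ¬ SameBlock T (x.symm a) (x.symm b) := by
        intro hs
        have := hs.apply_lt hT h
        simp only [Equiv.apply_symm_apply] at this
        exact absurd hab this.not_gt
      have := blockFlip_lt_of_not_sameBlock h hns
      simp only [this.not_gt, h.not_gt, false_and]
    · simp only [h, true_and]
      constructor
      · intro hf hs
        exact absurd hf (hs.symm.blockFlip_lt h).not_gt
      · intro hs
        exact blockFlip_lt_of_not_sameBlock h fun h' => hs h'.symm
  · simp only [hab, false_and]

lemma inverted_of_sameBlock {x : Equiv.Perm (Fin (m + 1))} {T : Finset (Fin m)}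
    (hT : T ⊆ Des x) {a b : Fin (m + 1)} (hab : a < b)
    (h : SameBlock T (x.symm a) (x.symm b)) : Inverted x a b := by
  refine ⟨hab, ?_⟩
  rcases lt_or_gt_of_ne (x.symm.injective.ne hab.ne) with h' | h'
  · have := h.apply_lt hT h'
    simp only [Equiv.apply_symm_apply] at this
    exact absurd hab this.not_gt
  · exact h'

lemma eq_one_of_not_inverted {x : Equiv.Perm (Fin (m + 1))} (h : ∀ a b, ¬ Inverted x a b) :
    x = 1 := by
  have hmono : StrictMono x.symm := by
    intro a b hab
    rcases lt_or_gt_of_ne (x.symm.injective.ne hab.ne) with h' | h'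
    · exact h'
    · exact absurd ⟨hab, h'⟩ (h a b)
  have : (⇑x.symm : Fin (m + 1) → Fin (m + 1)) = id :=
    hmono.range_inj strictMono_id |>.mp (by simp)
  ext1 i
  have := congrFun this (x i)
  simp only [Equiv.symm_apply_apply, id] at this
  rw [← this]
  rfl

lemma eq_revPerm_of_inverted {x : Equiv.Perm (Fin (m + 1))}
    (h : ∀ a b, a < b → Inverted x a b) : x = Fin.revPerm := by
  have hmono : StrictMono (fun a => Fin.rev (x.symm a)) := by
    intro a b hab
    exact Fin.rev_lt_rev.mpr (h a b hab).2
  have : (fun a => Fin.rev (x.symm a)) = id :=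
    hmono.range_inj strictMono_id |>.mp (by
      rw [Set.range_id]
      exact Function.Surjective.range_eq (Fin.rev_surjective.comp x.symm.surjective))
  ext1 i
  have := congrFun this (x i)
  simp only [Equiv.symm_apply_apply, id] at this
  rw [← this]
  rfl

lemma not_inverted_one (a b : Fin (m + 1)) : ¬ Inverted 1 a b := by
  rintro ⟨h, h'⟩
  exact absurd h (show b < a from h').not_gt

lemma inverted_revPerm {a b : Fin (m + 1)} (h : a < b) : Inverted Fin.revPerm a b :=
  ⟨h, by simpa using h⟩

lemma inverted_of_des {x : Equiv.Perm (Fin (m + 1))} {k : Fin m} (hk : k ∈ Des x) :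
    Inverted x (x k.succ) (x k.castSucc) := by
  refine ⟨by simpa [Des] using hk, by simp⟩

lemma des_nonempty {x : Equiv.Perm (Fin (m + 1))} (hx : x ≠ 1) : (Des x).Nonempty := by
  by_contra hc
  rw [Finset.not_nonempty_iff_eq_empty] at hc
  apply hx
  have hmono : StrictMono x := by
    rw [Fin.strictMono_iff_lt_succ]
    intro i
    have hi : i ∉ Des x := by simp [hc]
    simp only [Des, mem_filter, mem_univ, true_and, not_lt] at hi
    exact lt_of_le_of_ne hi (x.injective.ne (Fin.castSucc_lt_succ).ne)
  have : (⇑x : Fin (m + 1) → Fin (m + 1)) = id :=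
    hmono.range_inj strictMono_id |>.mp (by simp)
  ext1 i
  exact congrFun this i

lemma des_revPerm : Des (Fin.revPerm : Equiv.Perm (Fin (m + 1))) = univ := by
  ext k
  simp [Des]

/-- The number of inversions of a permutation. -/
noncomputable def invCount (x : Equiv.Perm (Fin (m + 1))) : ℕ :=
  #{q : Fin (m + 1) × Fin (m + 1) | Inverted x q.1 q.2}

lemma sameBlock_of_mem {T : Finset (Fin m)} {k : Fin m} (hk : k ∈ T) :
    SameBlock T k.succ k.castSucc := by
  intro l h1 h2
  simp only [Fin.val_succ, Fin.val_castSucc] at h1 h2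
  have : l = k := by ext; omega
  exact this ▸ hk

lemma invCount_ungarMove_lt {x : Equiv.Perm (Fin (m + 1))} {T : Finset (Fin m)}
    (hT : T ⊆ Des x) (hne : T.Nonempty) : invCount (ungarMove x T) < invCount x := by
  obtain ⟨k, hk⟩ := hne
  apply Finset.card_lt_card
  rw [Finset.ssubset_iff_of_subset]
  · refine ⟨(x k.succ, x k.castSucc), ?_, ?_⟩
    · simpa using inverted_of_des (hT hk)
    · simp only [mem_filter, mem_univ, true_and, inverted_ungarMove_iff hT,
        Equiv.symm_apply_apply]
      exact fun h => h.2 (sameBlock_of_mem hk)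
  · intro q hq
    simp only [mem_filter, mem_univ, true_and, inverted_ungarMove_iff hT] at hq ⊢
    exact hq.1

lemma ungarMove_empty (x : Equiv.Perm (Fin (m + 1))) : ungarMove x ∅ = x := by
  ext1 i
  have : blockFlip ∅ i = i := by
    by_contra hne
    have hne' : (blockFlip ∅ i : ℕ) ≠ i := fun h => hne (Fin.ext h)
    have := sameBlock_blockFlip ∅ i
    have := this ⟨min i (blockFlip ∅ i), by omega⟩ le_rfl (by simp; omega)
    simp at this
  rw [ungarMove_apply, this]

lemma ungarMove_revPerm_univ : ungarMove (Fin.revPerm : Equiv.Perm (Fin (m + 1))) univ = 1 := by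
  apply eq_one_of_not_inverted
  intro a b h
  rw [inverted_ungarMove_iff (by simp [des_revPerm])] at h
  exact h.2 fun k _ _ => mem_univ k

lemma ungarMove_revPerm_ne_one {T : Finset (Fin m)} (hT : T ≠ univ) :
    ungarMove Fin.revPerm T ≠ 1 := by
  obtain ⟨k, hk⟩ : ∃ k, k ∉ T := by
    by_contra! hc
    exact hT (Finset.eq_univ_iff_forall.mpr hc)
  intro h
  have hinv : Inverted (ungarMove Fin.revPerm T) (Fin.rev k.succ) (Fin.rev k.castSucc) := by
    rw [inverted_ungarMove_iff (by simp [des_revPerm])]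
    refine ⟨inverted_revPerm (by simp), fun hs => hk (hs k ?_ ?_)⟩ <;> simp
  rw [h] at hinv
  exact not_inverted_one _ _ hinv

/-- The identity can be reached from the given permutation in exactly `s` Ungar moves, some of
which may be trivial. -/
def Reaches : ℕ → Equiv.Perm (Fin (m + 1)) → Prop
  | 0, x => x = 1
  | s + 1, x => ∃ T ⊆ Des x, Reaches s (ungarMove x T)

lemma Reaches.exists_path {s : ℕ} {x : Equiv.Perm (Fin (m + 1))} (h : Reaches s x) :
    ∃ (F : ℕ → Equiv.Perm (Fin (m + 1))) (T : ℕ → Finset (Fin m)), F 0 = x ∧ F s = 1 ∧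
      ∀ k < s, T k ⊆ Des (F k) ∧ F (k + 1) = ungarMove (F k) (T k) := by
  induction s generalizing x with
  | zero => exact ⟨fun _ => x, fun _ => ∅, rfl, h, by simp⟩
  | succ s ih =>
    obtain ⟨T₀, hT₀, h⟩ := h
    obtain ⟨F, T, h0, hs, hF⟩ := ih h
    refine ⟨fun k => Nat.casesOn k x F, fun k => Nat.casesOn k T₀ T, rfl, hs, ?_⟩
    rintro (_ | k) hk
    · exact ⟨hT₀, h0⟩
    · exact hF k (by omega)

lemma le_of_path (hm : 4 ≤ m + 1) {t : ℕ} {F : ℕ → Equiv.Perm (Fin (m + 1))}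
    {T : ℕ → Finset (Fin m)} (h0 : F 0 = Fin.revPerm) (ht : F t = 1)
    (hF : ∀ k < t, T k ⊆ Des (F k) ∧ F (k + 1) = ungarMove (F k) (T k))
    (h1 : F 1 ≠ Fin.revPerm) (h1' : F 1 ≠ 1) : m ≤ t := by
  have hlast : ∀ a b, ∃ c, a < b → c < t ∧ ∀ k ≤ t, (Inverted (F k) a b ↔ k ≤ c) := by
    intro a b
    by_cases hab : a < b
    swap
    · exact ⟨0, fun h => absurd h hab⟩
    have hP0 : Inverted (F 0) a b := h0 ▸ inverted_revPerm hab
    have hanti : ∀ k j, k + j ≤ t → Inverted (F (k + j)) a b → Inverted (F k) a b := by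
      intro k j
      induction j with
      | zero => exact fun _ h => h
      | succ j ih =>
        intro hj h
        obtain ⟨hT, he⟩ := hF (k + j) (by omega)
        rw [← Nat.add_assoc, he, inverted_ungarMove_iff hT] at h
        exact ih (by omega) h.1
    have hex : ∃ k, ¬ Inverted (F k) a b := ⟨t, ht ▸ not_inverted_one a b⟩
    have hc := Nat.find_spec hex
    have hct : Nat.find hex ≤ t := Nat.find_min' hex (ht ▸ not_inverted_one a b)
    have hpos : Nat.find hex ≠ 0 := fun h => hc (h ▸ hP0)
    refine ⟨Nat.find hex - 1, fun _ => ⟨by omega, fun k hk => ?_⟩⟩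
    constructor
    · intro hi
      by_contra hlt
      refine hc (hanti _ (k - Nat.find hex) (by omega) ?_)
      rwa [show Nat.find hex + (k - Nat.find hex) = k by omega]
    · intro hle
      exact not_not.mp (Nat.find_min hex (show k < Nat.find hex by omega))
  choose c hc using hlast
  set τ : Fin (m + 1) → Fin (m + 1) → ℕ := fun a b => if a < b then c a b else c b a with hτdef
  have hτsymm : ∀ a b, τ a b = τ b a := by
    intro a b
    simp only [hτdef]
    rcases lt_trichotomy a b with h | rfl | h
    · simp [h, h.not_gt]
    · rfl
    · simp [h, h.not_gt]
  have hτlt : ∀ {a b}, a < b → τ a b = c a b := fun h => if_pos h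
  have hinv : ∀ {a b}, a < b → ∀ k ≤ t, (Inverted (F k) a b ↔ k ≤ τ a b) := by
    intro a b hab k hk
    rw [hτlt hab]
    exact (hc a b hab).2 k hk
  have hlt : ∀ {a b}, a < b → τ a b < t := by
    intro a b hab
    rw [hτlt hab]
    exact (hc a b hab).1
  have hblock : ∀ {a b}, a < b → ∀ k < t,
      (τ a b = k ↔ SameBlock (T k) ((F k).symm a) ((F k).symm b)) := by
    intro a b hab k hk
    have e1 := hinv hab k hk.le
    have e2 := hinv hab (k + 1) hk
    obtain ⟨hT, he⟩ := hF k hk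
    rw [he, inverted_ungarMove_iff hT] at e2
    constructor
    · rintro rfl
      by_contra hn
      have := e2.mp ⟨e1.mpr le_rfl, hn⟩
      omega
    · intro hs
      have := e1.mp (inverted_of_sameBlock hT hab hs)
      by_contra hne
      exact (e2.mpr (by omega)).2 hs
  have hsys : IsSwapTime t τ := by
    refine ⟨hτsymm, ?_, ?_⟩
    · intro a b hab
      rcases lt_or_gt_of_ne hab with h | h
      · exact hlt h
      · rw [hτsymm]
        exact hlt h
    · intro x y z hxy hyz
      have hxz := hxy.trans hyz
      have l1 := hlt hxy
      have l2 := hlt hyz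
      have l3 := hlt hxz
      have hmin : min (τ x y) (τ y z) ≤ τ x z := by
        rw [← hinv hxz _ (by omega)]
        exact ⟨hxz, ((hinv hyz _ (by omega)).mpr (by omega)).2.trans
          ((hinv hxy _ (by omega)).mpr (by omega)).2⟩
      have hmax : τ x z ≤ max (τ x y) (τ y z) := by
        by_contra! hgt
        have i1 : ¬ Inverted (F (τ x z)) x y := by
          rw [hinv hxy _ (by omega)]
          omega
        have i2 : ¬ Inverted (F (τ x z)) y z := by
          rw [hinv hyz _ (by omega)]
          omega
        have i3 := (hinv hxz _ (by omega)).mpr (le_refl (τ x z))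
        simp only [Inverted, hxy, hyz, true_and, not_lt] at i1 i2
        exact absurd i3.2 (i1.trans i2).not_gt
      have q1 : τ x y = τ x z → τ y z = τ x z := by
        intro h
        have b1 := (hblock hxy _ l3).mp h
        have b2 := (hblock hxz _ l3).mp rfl
        exact (hblock hyz _ l3).mpr (b1.symm.trans b2)
      have q2 : τ y z = τ x z → τ x y = τ x z := by
        intro h
        have b1 := (hblock hyz _ l3).mp h
        have b2 := (hblock hxz _ l3).mp rfl
        exact (hblock hxy _ l3).mpr (b2.trans b1.symm)
      omega
  have htpos : 1 ≤ t := by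
    by_contra hc
    obtain rfl : t = 0 := by omega
    have := inverted_revPerm (m := m) (a := 0) (b := Fin.last m)
      (Fin.lt_def.mpr (by simp; omega))
    rw [← h0, ht] at this
    exact not_inverted_one _ _ this
  refine hsys.le_of_not_const hm ?_
  by_contra! hconst
  obtain ⟨a, b, hab⟩ : ∃ a b, Inverted (F 1) a b := by
    by_contra! hn
    exact h1' (eq_one_of_not_inverted hn)
  refine h1 (eq_revPerm_of_inverted fun a' b' hab' => ?_)
  rw [hinv hab' 1 htpos, hconst a' b' a b hab'.ne hab.1.ne, ← hinv hab.1 1 htpos]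
  exact hab

/-- Ungar's theorem: after a nontrivial first move from the decreasing permutation which is not
maximal, at least `m - 1` further Ungar moves are needed to reach the identity. -/
lemma le_of_reaches_ungarMove_revPerm (hm : 4 ≤ m + 1) {T : Finset (Fin m)} (hne : T.Nonempty)
    (hT : T ≠ univ) {s : ℕ} (h : Reaches s (ungarMove Fin.revPerm T)) : m - 1 ≤ s := by
  have hr : Reaches (s + 1) (Fin.revPerm : Equiv.Perm (Fin (m + 1))) :=
    ⟨T, by simp [des_revPerm], h⟩
  obtain ⟨F, T', h0, hs, hF⟩ := h.exists_path
  have hTsub : T ⊆ Des (Fin.revPerm : Equiv.Perm (Fin (m + 1))) := by simp [des_revPerm]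
  have := le_of_path (t := s + 1) (F := fun k => Nat.casesOn k Fin.revPerm F)
    (T := fun k => Nat.casesOn k T T') hm rfl hs (by
      rintro (_ | k) hk
      · exact ⟨hTsub, h0⟩
      · exact hF k (by omega))
    (by
      intro he
      have h1 : ungarMove Fin.revPerm T = Fin.revPerm := h0.symm.trans he
      have := invCount_ungarMove_lt hTsub hne
      rw [h1] at this
      exact lt_irrefl _ this)
    (fun he => ungarMove_revPerm_ne_one hT (h0.symm.trans he))
  omega

end UngarMove

section Expectation

variable {m : ℕ} {p : ℝ} {E : Equiv.Perm (Fin (m + 1)) → ℝ}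

/-- The probability of choosing the subset `T` of the descent set `D`. -/
noncomputable def subsetWeight (p : ℝ) (D T : Finset (Fin m)) : ℝ :=
  p ^ #T * (1 - p) ^ (#D - #T)

lemma sum_subsetWeight (p : ℝ) (D : Finset (Fin m)) :
    ∑ T ∈ D.powerset, subsetWeight p D T = 1 := by
  unfold subsetWeight
  rw [Finset.sum_pow_mul_eq_add_pow]
  simp

lemma subsetWeight_nonneg (hp : 0 < p) (hp1 : p < 1) (D T : Finset (Fin m)) :
    0 ≤ subsetWeight p D T :=
  mul_nonneg (pow_nonneg hp.le _) (pow_nonneg (by linarith) _)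

lemma sum_weakP_mul (p : ℝ) (x : Equiv.Perm (Fin (m + 1))) (f : Equiv.Perm (Fin (m + 1)) → ℝ) :
    ∑ y, weakP p x y * f y =
      ∑ T ∈ (Des x).powerset, subsetWeight p (Des x) T * f (ungarMove x T) := by
  unfold weakP
  simp only [isUngarMoveTo_iff, Finset.sum_mul, Finset.sum_filter]
  rw [Finset.sum_comm]
  refine Finset.sum_congr rfl fun T _ => ?_
  simp [subsetWeight]

lemma sum_nonempty_subsets (D : Finset (Fin m)) (f : Finset (Fin m) → ℝ) :
    ∑ T ∈ D.powerset, f T = f ∅ + ∑ T ∈ D.powerset.erase ∅, f T :=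
  (Finset.add_sum_erase _ _ (Finset.empty_mem_powerset D)).symm

lemma IsWeakOrderExp.recurrence (hE : IsWeakOrderExp p E) {x : Equiv.Perm (Fin (m + 1))}
    (hx : x ≠ 1) : E x * (1 - (1 - p) ^ #(Des x)) =
      1 + ∑ T ∈ (Des x).powerset.erase ∅, subsetWeight p (Des x) T * E (ungarMove x T) := by
  have h := hE.2 x hx
  rw [sum_weakP_mul, sum_nonempty_subsets, ungarMove_empty] at h
  simp only [subsetWeight, card_empty, pow_zero, one_mul, Nat.sub_zero] at h ⊢
  linarith

lemma sum_subsetWeight_nonempty (p : ℝ) (D : Finset (Fin m)) :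
    ∑ T ∈ D.powerset.erase ∅, subsetWeight p D T = 1 - (1 - p) ^ #D := by
  have h := sum_subsetWeight p D
  rw [sum_nonempty_subsets] at h
  simp only [subsetWeight, card_empty, pow_zero, one_mul, Nat.sub_zero] at h ⊢
  linarith

lemma one_sub_pow_pos (hp : 0 < p) (hp1 : p < 1) {n : ℕ} (hn : n ≠ 0) :
    0 < 1 - (1 - p) ^ n :=
  sub_pos.mpr (pow_lt_one₀ (by linarith) (by linarith) hn)

lemma IsWeakOrderExp.le_of_not_reaches (hp : 0 < p) (hp1 : p < 1) (hE : IsWeakOrderExp p E)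
    (s : ℕ) (x : Equiv.Perm (Fin (m + 1))) (hx : ∀ k < s, ¬ Reaches k x) : (s : ℝ) ≤ E x := by
  induction hN : invCount x using Nat.strong_induction_on generalizing x s with
  | _ N ih =>
    rcases eq_or_ne x 1 with rfl | hne
    · have : s = 0 := by
        by_contra h0
        exact hx 0 (by omega) rfl
      rw [this, hE.1, Nat.cast_zero]
    · have hstep : ∀ T ∈ (Des x).powerset.erase ∅, (s : ℝ) - 1 ≤ E (ungarMove x T) := by
        intro T hT
        rw [mem_erase, mem_powerset] at hT
        have hlt := invCount_ungarMove_lt hT.2 (Finset.nonempty_iff_ne_empty.mpr hT.1)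
        have := ih _ (hN ▸ hlt) (s - 1) (ungarMove x T)
          (fun k hk hr => hx (k + 1) (by omega) ⟨T, hT.2, hr⟩) rfl
        refine le_trans ?_ this
        have : (s : ℝ) ≤ ((s - 1 + 1 : ℕ) : ℝ) := by exact_mod_cast (by omega : s ≤ s - 1 + 1)
        push_cast at this
        linarith
      have hq := one_sub_pow_pos hp hp1 (des_nonempty hne).card_ne_zero
      have hq1 : 0 ≤ (1 - p) ^ #(Des x) := pow_nonneg (by linarith) _
      have hrec := hE.recurrence hne
      have hsum : ((s : ℝ) - 1) * (1 - (1 - p) ^ #(Des x)) ≤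
          ∑ T ∈ (Des x).powerset.erase ∅, subsetWeight p (Des x) T * E (ungarMove x T) := by
        rw [← sum_subsetWeight_nonempty, Finset.mul_sum]
        refine Finset.sum_le_sum fun T hT => ?_
        rw [mul_comm]
        exact mul_le_mul_of_nonneg_left (hstep T hT) (subsetWeight_nonneg hp hp1 _ _)
      refine le_of_mul_le_mul_right ?_ hq
      linarith

end Expectation

/-- For fixed `p ∈ (0,1)` and `n = m + 1 ≥ 4`, the expected number
of steps of the Ungarian Markov chain on the weak order of `S_n`, from the decreasing
permutation to the identity, satisfies
`𝓔(S_n) ≥ n - 2 + (1 - p^(n-1) (n-2)) / (1 - (1-p)^(n-1))`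
(the recursive lower bound derived from Ungar's theorem); in particular
`𝓔(S_n) ≥ n - 1 + o(1)`. -/
theorem stmt_10 {m : ℕ} (hm : 4 ≤ m + 1) (p : ℝ) (hp : 0 < p) (hp1 : p < 1)
    (E : Equiv.Perm (Fin (m + 1)) → ℝ) (hE : IsWeakOrderExp p E) :
    ((m : ℝ) + 1) - 2 + (1 - p ^ m * (((m : ℝ) + 1) - 2)) / (1 - (1 - p) ^ m) ≤
      E Fin.revPerm := by
  have hrec := hE.recurrence (x := Fin.revPerm) (by
    intro h
    have := inverted_revPerm (m := m) (a := 0) (b := Fin.last m)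
      (Fin.lt_def.mpr (by simp; omega))
    rw [h] at this
    exact not_inverted_one _ _ this)
  have hw := sum_subsetWeight_nonempty p (univ : Finset (Fin m))
  have hmem : (univ : Finset (Fin m)) ∈ (univ : Finset (Fin m)).powerset.erase ∅ := by
    have : Nonempty (Fin m) := ⟨⟨0, by omega⟩⟩
    simp [Finset.univ_nonempty.ne_empty]
  rw [des_revPerm, ← Finset.add_sum_erase _ _ hmem, ungarMove_revPerm_univ, hE.1] at hrec
  rw [← Finset.add_sum_erase _ _ hmem] at hw
  have hwu : subsetWeight p (univ : Finset (Fin m)) univ = p ^ m := by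
    simp [subsetWeight]
  rw [hwu] at hw
  rw [card_univ, Fintype.card_fin] at hw hrec
  have hsum : (∑ T ∈ ((univ : Finset (Fin m)).powerset.erase ∅).erase univ,
      subsetWeight p univ T) * ((m : ℝ) - 1) ≤
      ∑ T ∈ ((univ : Finset (Fin m)).powerset.erase ∅).erase univ,
        subsetWeight p univ T * E (ungarMove Fin.revPerm T) := by
    rw [Finset.sum_mul]
    refine Finset.sum_le_sum fun T hT => ?_
    refine mul_le_mul_of_nonneg_left ?_ (subsetWeight_nonneg hp hp1 _ _)
    simp only [mem_erase] at hT
    have := hE.le_of_not_reaches hp hp1 (m - 1) (ungarMove Fin.revPerm T) fun k hk hr => by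
      have := le_of_reaches_ungarMove_revPerm hm
        (Finset.nonempty_iff_ne_empty.mpr hT.2.1) hT.1 hr
      omega
    rwa [Nat.cast_sub (by omega), Nat.cast_one] at this
  rw [eq_sub_of_add_eq' hw] at hsum
  have hq := one_sub_pow_pos hp hp1 (n := m) (by omega)
  have heq : (E Fin.revPerm - ((m : ℝ) + 1 - 2)) * (1 - (1 - p) ^ m) ≥
      1 - p ^ m * ((m : ℝ) + 1 - 2) := by
    rw [sub_mul, hrec]
    linarith
  have := (div_le_iff₀ hq).mpr heq
  linarith
end
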